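/- arXiv:1310.4095 — 4 statements merged into one kernel-verified Lean document; each statement's English description precedes it below -/
import Mathlib

section
/- Let a ≠ b be two indices. Suppose H(x)φ_a(x) = λ_a(x)φ_a(x) and H(x)φ_b(x) = λ_b(x)φ_b(x) hold for all x ∈ U, that ⟪φ_b(x), φ_a(x)⟫ = 0 for all x ∈ U, and that H, φ_a, φ_b, λ_a, λ_b are differentiable at x₀ ∈ U. Then for every direction u ∈ E: ⟪φ_b(x₀), (D_u H)(x₀)(φ_a(x₀))⟫ = (λ_a(x₀) − λ_b(x₀)) · ⟪φ_b(x₀), (D_u φ_a)(x₀)⟫. -/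
open scoped ComplexInnerProductSpace

/-- For two eigenvector families `φa, φb` of a self-adjoint family `Hop` of
operators, with mutually orthogonal eigenvectors on an open set `U`, at any `x₀ ∈ U` and any
direction `u` we have `⟪φb, (D_u Hop) φa⟫ = (λa − λb) ⟪φb, D_u φa⟫`. -/
theorem stmt_0
    {E : Type*} [NormedAddCommGroup E] [NormedSpace ℝ E]
    {H : Type*} [NormedAddCommGroup H] [InnerProductSpace ℂ H] [FiniteDimensional ℂ H]
    (U : Set E) (hU : IsOpen U) (x₀ : E) (hx₀ : x₀ ∈ U)
    (Hop : E → (H →L[ℂ] H)) (φa φb : E → H) (lama lamb : E → ℝ)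
    (hsa : ∀ x ∈ U, ∀ v w : H, ⟪Hop x v, w⟫ = ⟪v, Hop x w⟫)
    (heiga : ∀ x ∈ U, Hop x (φa x) = (lama x : ℂ) • φa x)
    (heigb : ∀ x ∈ U, Hop x (φb x) = (lamb x : ℂ) • φb x)
    (horth : ∀ x ∈ U, ⟪φb x, φa x⟫ = 0)
    (hH : DifferentiableAt ℝ Hop x₀)
    (hφa : DifferentiableAt ℝ φa x₀) (hφb : DifferentiableAt ℝ φb x₀)
    (hlama : DifferentiableAt ℝ lama x₀) (hlamb : DifferentiableAt ℝ lamb x₀)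
    (u : E) :
    ⟪φb x₀, (fderiv ℝ Hop x₀ u) (φa x₀)⟫
      = ((lama x₀ - lamb x₀ : ℝ) : ℂ) * ⟪φb x₀, fderiv ℝ φa x₀ u⟫ := by
  have hc : HasFDerivAt (fun x => (Hop x).restrictScalars ℝ)
      ((ContinuousLinearMap.restrictScalarsL ℂ H H ℝ ℝ).comp (fderiv ℝ Hop x₀)) x₀ :=
    (ContinuousLinearMap.restrictScalarsL ℂ H H ℝ ℝ).hasFDerivAt.comp x₀ hH.hasFDerivAt
  have hleft := hc.clm_apply hφa.hasFDerivAt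
  have hright := hlama.hasFDerivAt.smul hφa.hasFDerivAt
  have heq : (fun x => lama x • φa x) =ᶠ[nhds x₀]
      fun x => (Hop x).restrictScalars ℝ (φa x) := by
    filter_upwards [hU.mem_nhds hx₀] with x hx
    simp [heiga x hx]
  have hderiv := congrArg (fun L : E →L[ℝ] H => ⟪φb x₀, L u⟫)
    ((hleft.congr_of_eventuallyEq heq).unique hright)
  have hb : ⟪φb x₀, Hop x₀ (fderiv ℝ φa x₀ u)⟫
      = (lamb x₀ : ℂ) * ⟪φb x₀, fderiv ℝ φa x₀ u⟫ := by
    rw [← hsa x₀ hx₀, heigb x₀ hx₀, inner_smul_left, Complex.conj_ofReal]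
  simp [← Complex.coe_smul, horth x₀ hx₀, hb] at hderiv
  push_cast
  linear_combination hderiv
end

section
/- (Proposition 1, components of the adiabatic curvature.) Fix an index a ∈ B and a point x₀ ∈ U, and assume λ_b(x₀) ≠ λ_a(x₀) for every b ≠ a. Then for all directions u, v ∈ E, the component of the adiabatic curvature F_a(u,v) := ⟪(D_u φ_a)(x₀), (D_v φ_a)(x₀)⟫ − ⟪(D_v φ_a)(x₀), (D_u φ_a)(x₀)⟫ satisfies F_a(u,v) = ∑_{b≠a} [ ⟪φ_a, (D_u H)(φ_b)⟫·⟪φ_b, (D_v H)(φ_a)⟫ − ⟪φ_a, (D_v H)(φ_b)⟫·⟪φ_b, (D_u H)(φ_a)⟫ ] / (λ_a(x₀) − λ_b(x₀))², where all quantities are evaluated at x₀. -/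
open scoped ComplexInnerProductSpace

/-- The product rule for a real-differentiable family of complex-linear operators applied to a
real-differentiable family of vectors. -/
theorem fderiv_complexClm_apply
    {E : Type*} [NormedAddCommGroup E] [NormedSpace ℝ E]
    {F : Type*} [NormedAddCommGroup F] [NormedSpace ℂ F]
    {A : E → (F →L[ℂ] F)} {f : E → F} {x : E}
    (hA : DifferentiableAt ℝ A x) (hf : DifferentiableAt ℝ f x) (u : E) :
    fderiv ℝ (fun y => A y (f y)) x u = fderiv ℝ A x u (f x) + A x (fderiv ℝ f x u) := by
  have hA' : HasFDerivAt (fun y => (A y).restrictScalars ℝ)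
      ((ContinuousLinearMap.restrictScalarsL ℂ F F ℝ ℝ).comp (fderiv ℝ A x)) x :=
    (ContinuousLinearMap.restrictScalarsL ℂ F F ℝ ℝ).hasFDerivAt.comp x hA.hasFDerivAt
  have h : HasFDerivAt (fun y => A y (f y)) _ x := hA'.clm_apply hf.hasFDerivAt
  rw [h.fderiv]
  simp [add_comm]

/-- The derivative of a family of symmetric operators is symmetric. -/
theorem inner_fderiv_symmetric
    {E : Type*} [NormedAddCommGroup E] [NormedSpace ℝ E]
    {F : Type*} [NormedAddCommGroup F] [InnerProductSpace ℂ F]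
    {A : E → (F →L[ℂ] F)} {x : E} (hA : DifferentiableAt ℝ A x)
    (hsymm : ∀ᶠ y in nhds x, ∀ v w : F, ⟪A y v, w⟫ = ⟪v, A y w⟫) (u : E) (v w : F) :
    ⟪fderiv ℝ A x u v, w⟫ = ⟪v, fderiv ℝ A x u w⟫ := by
  have happ (z : F) : DifferentiableAt ℝ (fun y => A y z) x :=
    ((ContinuousLinearMap.apply ℂ F z).restrictScalars ℝ).differentiableAt.comp x hA
  have hz (z : F) : fderiv ℝ (fun y => A y z) x u = fderiv ℝ A x u z := by
    simpa using fderiv_complexClm_apply hA (differentiableAt_const z) u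
  have key : (fun y => ⟪A y v, w⟫) =ᶠ[nhds x] fun y => ⟪v, A y w⟫ :=
    hsymm.mono fun y hy => hy v w
  have h := congrArg (fun L : E →L[ℝ] ℂ => L u) key.fderiv_eq
  simpa [fderiv_inner_apply ℂ (happ v) (differentiableAt_const w),
    fderiv_inner_apply ℂ (differentiableAt_const v) (happ w), hz] using h

/-- The derivative of a family of unit vectors has purely imaginary inner product with it. -/
theorem inner_fderiv_add_inner_fderiv_eq_zero
    {E : Type*} [NormedAddCommGroup E] [NormedSpace ℝ E]
    {F : Type*} [NormedAddCommGroup F] [InnerProductSpace ℂ F]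
    {f : E → F} {x : E} (hf : DifferentiableAt ℝ f x) (hnorm : ∀ᶠ y in nhds x, ‖f y‖ = 1)
    (u : E) : ⟪f x, fderiv ℝ f x u⟫ + ⟪fderiv ℝ f x u, f x⟫ = 0 := by
  have key : (fun y => ⟪f y, f y⟫) =ᶠ[nhds x] fun _ => (1 : ℂ) :=
    hnorm.mono fun y hy => by simp [inner_self_eq_norm_sq_to_K, hy]
  have h := congrArg (fun L : E →L[ℝ] ℂ => L u) key.fderiv_eq
  simpa [fderiv_inner_apply ℂ hf hf, -inner_self_eq_norm_sq_to_K] using h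

/-- Off-diagonal Hellmann–Feynman formula: the derivative of an eigenvector tested against another
eigenvector of a symmetric operator. -/
theorem inner_fderiv_apply_eigenvector
    {E : Type*} [NormedAddCommGroup E] [NormedSpace ℝ E]
    {F : Type*} [NormedAddCommGroup F] [InnerProductSpace ℂ F]
    {A : E → (F →L[ℂ] F)} {f : E → F} {l : E → ℝ} {x : E} {g : F} {m : ℝ}
    (hA : DifferentiableAt ℝ A x) (hf : DifferentiableAt ℝ f x) (hl : DifferentiableAt ℝ l x)
    (hsymm : ∀ v w : F, ⟪A x v, w⟫ = ⟪v, A x w⟫)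
    (heig : ∀ᶠ y in nhds x, A y (f y) = (l y : ℂ) • f y)
    (hg : A x g = (m : ℂ) • g) (horth : ⟪g, f x⟫ = 0) (u : E) :
    ⟪g, fderiv ℝ A x u (f x)⟫ = ((l x - m : ℝ) : ℂ) * ⟪g, fderiv ℝ f x u⟫ := by
  have key : (fun y => A y (f y)) =ᶠ[nhds x] fun y => l y • f y :=
    heig.mono fun y hy => by simpa using hy
  have h := congrArg (fun L : E →L[ℝ] F => ⟪g, L u⟫) key.fderiv_eq
  simp only [fderiv_complexClm_apply hA hf, fderiv_fun_smul hl hf] at h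
  simp only [add_apply, smul_apply,
    ContinuousLinearMap.smulRight_apply, inner_add_right, ← Complex.coe_smul, inner_smul_right,
    horth, ← hsymm, hg, inner_smul_left, Complex.conj_ofReal] at h
  push_cast
  linear_combination h

/-- Proposition 1: the component `F_a(u,v)` of the adiabatic curvature equals
the sum over `b ≠ a` of `(⟪φ_a, (D_u H) φ_b⟫⟪φ_b, (D_v H) φ_a⟫ − (u ↔ v)) / (λ_a − λ_b)²`. -/
theorem stmt_2
    {E : Type*} [NormedAddCommGroup E] [NormedSpace ℝ E]
    {H : Type*} [NormedAddCommGroup H] [InnerProductSpace ℂ H] [FiniteDimensional ℂ H]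
    {B : Type*} [Fintype B] [DecidableEq B]
    (U : Set E) (hU : IsOpen U) (x₀ : E) (hx₀ : x₀ ∈ U)
    (Hop : E → (H →L[ℂ] H)) (φ : B → E → H) (lam : B → E → ℝ)
    (hsa : ∀ x ∈ U, ∀ v w : H, ⟪Hop x v, w⟫ = ⟪v, Hop x w⟫)
    (heig : ∀ b, ∀ x ∈ U, Hop x (φ b x) = (lam b x : ℂ) • φ b x)
    (hON : ∀ x ∈ U, Orthonormal ℂ (fun b => φ b x))
    (hspan : ∀ x ∈ U, Submodule.span ℂ (Set.range fun b => φ b x) = ⊤)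
    (hH : DifferentiableAt ℝ Hop x₀)
    (hdiff : ∀ b, DifferentiableAt ℝ (φ b) x₀)
    (hlam : ∀ b, DifferentiableAt ℝ (lam b) x₀)
    (a : B) (hgap : ∀ b, b ≠ a → lam b x₀ ≠ lam a x₀)
    (u v : E) :
    ⟪fderiv ℝ (φ a) x₀ u, fderiv ℝ (φ a) x₀ v⟫
        - ⟪fderiv ℝ (φ a) x₀ v, fderiv ℝ (φ a) x₀ u⟫
      = ∑ b ∈ Finset.univ.erase a,
          (⟪φ a x₀, (fderiv ℝ Hop x₀ u) (φ b x₀)⟫ * ⟪φ b x₀, (fderiv ℝ Hop x₀ v) (φ a x₀)⟫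
            - ⟪φ a x₀, (fderiv ℝ Hop x₀ v) (φ b x₀)⟫ * ⟪φ b x₀, (fderiv ℝ Hop x₀ u) (φ a x₀)⟫)
            / ((lam a x₀ - lam b x₀ : ℝ) : ℂ) ^ 2 := by
  have hnhds := hU.mem_nhds hx₀
  have hsymm : ∀ᶠ y in nhds x₀, ∀ v w : H, ⟪Hop y v, w⟫ = ⟪v, Hop y w⟫ :=
    Filter.eventually_of_mem hnhds hsa
  have hnorm : ∀ᶠ y in nhds x₀, ‖φ a y‖ = 1 :=
    Filter.eventually_of_mem hnhds fun y hy => (hON y hy).1 a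
  have hright (w : E) (b : B) (hb : b ≠ a) :
      ⟪φ b x₀, fderiv ℝ Hop x₀ w (φ a x₀)⟫
        = ((lam a x₀ - lam b x₀ : ℝ) : ℂ) * ⟪φ b x₀, fderiv ℝ (φ a) x₀ w⟫ :=
    inner_fderiv_apply_eigenvector hH (hdiff a) (hlam a) (hsa x₀ hx₀)
      (Filter.eventually_of_mem hnhds (heig a)) (heig b x₀ hx₀) ((hON x₀ hx₀).2 hb) w
  have hleft (w : E) (b : B) (hb : b ≠ a) :
      ⟪φ a x₀, fderiv ℝ Hop x₀ w (φ b x₀)⟫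
        = ((lam a x₀ - lam b x₀ : ℝ) : ℂ) * ⟪fderiv ℝ (φ a) x₀ w, φ b x₀⟫ := by
    rw [← inner_fderiv_symmetric hH hsymm, ← inner_conj_symm, hright w b hb, map_mul,
      Complex.conj_ofReal, inner_conj_symm]
  let e := OrthonormalBasis.mk (hON x₀ hx₀) (hspan x₀ hx₀).ge
  have hparseval (p q : H) : ⟪p, q⟫ = ∑ b, ⟪p, φ b x₀⟫ * ⟪φ b x₀, q⟫ := by
    simpa [e] using (e.sum_inner_mul_inner p q).symm
  rw [hparseval, hparseval (fderiv ℝ (φ a) x₀ v), ← Finset.sum_sub_distrib,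
    ← Finset.add_sum_erase _ _ (Finset.mem_univ a)]
  have hu := inner_fderiv_add_inner_fderiv_eq_zero (hdiff a) hnorm u
  have hv := inner_fderiv_add_inner_fderiv_eq_zero (hdiff a) hnorm v
  have hdiag : ⟪fderiv ℝ (φ a) x₀ u, φ a x₀⟫ * ⟪φ a x₀, fderiv ℝ (φ a) x₀ v⟫
      - ⟪fderiv ℝ (φ a) x₀ v, φ a x₀⟫ * ⟪φ a x₀, fderiv ℝ (φ a) x₀ u⟫ = 0 := by
    linear_combination ⟪φ a x₀, fderiv ℝ (φ a) x₀ v⟫ * hu - ⟪φ a x₀, fderiv ℝ (φ a) x₀ u⟫ * hv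
  rw [hdiag, zero_add]
  refine Finset.sum_congr rfl fun b hb => ?_
  have hba := Finset.ne_of_mem_erase hb
  have hne : ((lam a x₀ - lam b x₀ : ℝ) : ℂ) ≠ 0 :=
    Complex.ofReal_ne_zero.2 (sub_ne_zero.2 (hgap b hba).symm)
  rw [hleft u b hba, hleft v b hba, hright u b hba, hright v b hba, eq_div_iff (pow_ne_zero 2 hne)]
  ring
end

section
/- (C*-geometric phase generator of a Schmidt-decomposed eigenstate.) Let ι be a finite index set, p : ι → ℝ with 0 < p_k for all k, and let ζ_k : U → ℂ^n and ξ_k : U → ℂ^m (k ∈ ι) be differentiable maps such that (ζ_k(x))_k and (ξ_k(x))_k are orthonormal families for every x ∈ U. Define φ(x)(i,α) = ∑_{k∈ι} √(p_k)·ζ_k(x)(i)·ξ_k(x)(α), and at a point x₀ ∈ U and direction u ∈ E set T(u) = Tr_E( |D_uφ(x₀)⟩⟨φ(x₀)| ) and σ = ∑_{k∈ι} p_k⁻¹·|ζ_k(x₀)⟩⟨ζ_k(x₀)| (the Moore–Penrose pseudo-inverse of the reduced density matrix ρ = ∑_k p_k|ζ_k(x₀)⟩⟨ζ_k(x₀)|).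 Then the generator 𝒜(u) = T(u)·σ of the C*-geometric phase satisfies 𝒜(u) = ∑_{k∈ι} |D_uζ_k(x₀)⟩⟨ζ_k(x₀)| + ∑_{k,l∈ι} √(p_k/p_l) · ⟪ξ_l(x₀), D_uξ_k(x₀)⟫ · |ζ_k(x₀)⟩⟨ζ_l(x₀)|. -/
open scoped ComplexInnerProductSpace

/-- `|v⟩⟨w|`: the matrix with entries `(i,j) ↦ v i * conj (w j)`. -/
noncomputable def ketbra {n : Type*} [Fintype n] (v w : EuclideanSpace ℂ n) :
    Matrix n n ℂ :=
  Matrix.of fun i j => v i * (starRingEnd ℂ) (w j)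

/-- The partial trace over the second (environment) factor of `|χ⟩⟨ψ|`:
the matrix with entries `(i,j) ↦ ∑ α, χ (i,α) * conj (ψ (j,α))`. -/
noncomputable def ptraceE {n m : Type*} [Fintype n] [Fintype m]
    (χ ψ : EuclideanSpace ℂ (n × m)) : Matrix n n ℂ :=
  Matrix.of fun i j => ∑ α, χ (i, α) * (starRingEnd ℂ) (ψ (j, α))

/-- The elementary tensor `v ⊗ w`, with entries `(i,α) ↦ v i * w α`. -/
noncomputable def tensorVec {n m : Type*} (v : EuclideanSpace ℂ n) (w : EuclideanSpace ℂ m) :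
    EuclideanSpace ℂ (n × m) :=
  WithLp.toLp 2 fun q => v q.1 * w q.2

@[simp]
lemma tensorVec_apply {n m : Type*} (v : EuclideanSpace ℂ n) (w : EuclideanSpace ℂ m)
    (i : n) (α : m) : tensorVec v w (i, α) = v i * w α := rfl

lemma ketbra_mul_ketbra {n : Type*} [Fintype n] (a b c d : EuclideanSpace ℂ n) :
    ketbra a b * ketbra c d = ⟪b, c⟫ • ketbra a d := by
  ext i j
  simp only [ketbra, Matrix.mul_apply, Matrix.of_apply, Matrix.smul_apply, PiLp.inner_apply,
    RCLike.inner_apply, smul_eq_mul, Finset.sum_mul]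
  exact Finset.sum_congr rfl fun _ _ => by ring

lemma ketbra_mul_sum_smul_ketbra {n ι : Type*} [Fintype n] [Fintype ι]
    {e : ι → EuclideanSpace ℂ n} (he : Orthonormal ℂ e) (c : ι → ℂ)
    (v : EuclideanSpace ℂ n) (l : ι) :
    ketbra v (e l) * ∑ k, c k • ketbra (e k) (e k) = c l • ketbra v (e l) := by
  classical
  simp [Finset.mul_sum, ketbra_mul_ketbra, orthonormal_iff_ite.mp he]

lemma ptraceE_tensorVec {n m : Type*} [Fintype n] [Fintype m]
    (v v' : EuclideanSpace ℂ n) (w w' : EuclideanSpace ℂ m) :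
    ptraceE (tensorVec v w) (tensorVec v' w') = ⟪w', w⟫ • ketbra v v' := by
  ext i j
  simp only [ptraceE, ketbra, Matrix.of_apply, Matrix.smul_apply, PiLp.inner_apply,
    RCLike.inner_apply, smul_eq_mul, Finset.sum_mul, tensorVec_apply, map_mul]
  exact Finset.sum_congr rfl fun _ _ => by ring

lemma ptraceE_add_left {n m : Type*} [Fintype n] [Fintype m]
    (χ χ' ψ : EuclideanSpace ℂ (n × m)) :
    ptraceE (χ + χ') ψ = ptraceE χ ψ + ptraceE χ' ψ := by
  ext i j
  simp [ptraceE, add_mul, Finset.sum_add_distrib]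

lemma ptraceE_sum_smul {n m ι κ : Type*} [Fintype n] [Fintype m] [Fintype ι] [Fintype κ]
    (a : ι → ℂ) (b : κ → ℝ) (χ : ι → EuclideanSpace ℂ (n × m))
    (ψ : κ → EuclideanSpace ℂ (n × m)) :
    ptraceE (∑ k, a k • χ k) (∑ l, (b l : ℂ) • ψ l)
      = ∑ k, ∑ l, (a k * b l) • ptraceE (χ k) (ψ l) := by
  ext i j
  simp only [ptraceE, Matrix.of_apply, Matrix.sum_apply, Matrix.smul_apply, WithLp.ofLp_sum,
    Finset.sum_apply, PiLp.smul_apply, smul_eq_mul, map_sum, map_mul, Complex.conj_ofReal,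
    Finset.sum_mul_sum]
  rw [Finset.sum_comm]
  refine Finset.sum_congr rfl fun k _ => ?_
  rw [Finset.sum_comm]
  refine Finset.sum_congr rfl fun l _ => ?_
  rw [Finset.mul_sum]
  exact Finset.sum_congr rfl fun _ _ => by ring

lemma DifferentiableAt.hasFDerivAt_euclideanSpace_apply {E : Type*} [NormedAddCommGroup E]
    [NormedSpace ℝ E] {n : Type*} [Fintype n] {f : E → EuclideanSpace ℂ n} {x : E}
    (hf : DifferentiableAt ℝ f x) (i : n) :
    HasFDerivAt (fun y => f y i) (PiLp.proj 2 (fun _ : n => ℂ) i ∘L fderiv ℝ f x) x :=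
  ((PiLp.proj (𝕜 := ℝ) 2 (fun _ : n => ℂ) i).hasFDerivAt).comp x hf.hasFDerivAt

lemma fderiv_sum_smul_tensorVec {E : Type*} [NormedAddCommGroup E] [NormedSpace ℝ E]
    {n m ι : Type*} [Fintype n] [Fintype m] [Fintype ι] (c : ι → ℂ)
    {ζ : ι → E → EuclideanSpace ℂ n} {ξ : ι → E → EuclideanSpace ℂ m} {x : E}
    (hζ : ∀ k, DifferentiableAt ℝ (ζ k) x) (hξ : ∀ k, DifferentiableAt ℝ (ξ k) x) (u : E) :
    fderiv ℝ (fun y => ∑ k, c k • tensorVec (ζ k y) (ξ k y)) x u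
      = ∑ k, c k • tensorVec (fderiv ℝ (ζ k) x u) (ξ k x)
        + ∑ k, c k • tensorVec (ζ k x) (fderiv ℝ (ξ k) x u) := by
  have hcoord (i : n) (α : m) := HasFDerivAt.fun_sum (u := Finset.univ) fun k _ =>
    ((hζ k).hasFDerivAt_euclideanSpace_apply i |>.mul
      ((hξ k).hasFDerivAt_euclideanSpace_apply α)).const_mul (c k)
  have happly (y : E) (i : n) (α : m) : (∑ k, c k • tensorVec (ζ k y) (ξ k y)) (i, α)
      = ∑ k, c k * (ζ k y i * ξ k y α) := by simp
  have hd : DifferentiableAt ℝ (fun y => ∑ k, c k • tensorVec (ζ k y) (ξ k y)) x := by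
    refine (differentiableAt_piLp 2).2 fun ⟨i, α⟩ => ?_
    simp only [happly]
    exact (hcoord i α).differentiableAt
  ext ⟨i, α⟩
  have h := hd.hasFDerivAt_euclideanSpace_apply (i, α)
  simp only [happly] at h
  have h' := DFunLike.congr_fun (h.unique (hcoord i α)) u
  simp only [ContinuousLinearMap.comp_apply, PiLp.proj_apply] at h'
  rw [h']
  simp only [sum_apply, smul_apply,
    add_apply, ContinuousLinearMap.comp_apply, PiLp.proj_apply,
    PiLp.add_apply, WithLp.ofLp_sum, Finset.sum_apply, PiLp.smul_apply, tensorVec_apply,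
    smul_eq_mul, ← Finset.sum_add_distrib]
  exact Finset.sum_congr rfl fun k _ => by ring

/-- the generator `𝒜(u) = Tr_E(|D_uφ⟩⟨φ|)·σ` of the `C*`-geometric phase of a
Schmidt-decomposed eigenstate `φ(x)(i,α) = ∑ k, √(p k) ζ_k(x)(i) ξ_k(x)(α)` equals
`∑ k, |D_uζ_k⟩⟨ζ_k| + ∑ k l, √(p k / p l) ⟪ξ_l, D_uξ_k⟫ |ζ_k⟩⟨ζ_l|`. -/
theorem stmt_13
    {E : Type*} [NormedAddCommGroup E] [NormedSpace ℝ E]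
    {n m ι : Type*} [Fintype n] [Fintype m] [Fintype ι]
    (U : Set E) (hU : IsOpen U) (x₀ : E) (hx₀ : x₀ ∈ U)
    (p : ι → ℝ) (hp : ∀ k, 0 < p k)
    (ζ : ι → E → EuclideanSpace ℂ n) (ξ : ι → E → EuclideanSpace ℂ m)
    (hζd : ∀ k, DifferentiableOn ℝ (ζ k) U) (hξd : ∀ k, DifferentiableOn ℝ (ξ k) U)
    (hζ : ∀ x ∈ U, Orthonormal ℂ (fun k => ζ k x))
    (hξ : ∀ x ∈ U, Orthonormal ℂ (fun k => ξ k x))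
    (φ : E → EuclideanSpace ℂ (n × m))
    (hφ : ∀ x ∈ U, ∀ i α, φ x (i, α) = ∑ k, (Real.sqrt (p k) : ℂ) * ζ k x i * ξ k x α)
    (u : E) :
    ptraceE (fderiv ℝ φ x₀ u) (φ x₀)
        * (∑ k, ((p k : ℂ)⁻¹ • ketbra (ζ k x₀) (ζ k x₀)))
      = ∑ k, ketbra (fderiv ℝ (ζ k) x₀ u) (ζ k x₀)
          + ∑ k, ∑ l,
              ((Real.sqrt (p k / p l) : ℂ) * ⟪ξ l x₀, fderiv ℝ (ξ k) x₀ u⟫)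
                • ketbra (ζ k x₀) (ζ l x₀) := by
  classical
  have hnhds : U ∈ nhds x₀ := hU.mem_nhds hx₀
  have hsum : ∀ x ∈ U, φ x = ∑ k, (Real.sqrt (p k) : ℂ) • tensorVec (ζ k x) (ξ k x) := by
    intro x hx
    ext ⟨i, α⟩
    simp [hφ x hx, mul_assoc]
  have hderiv : fderiv ℝ φ x₀ = fderiv ℝ
      (fun x => ∑ k, (Real.sqrt (p k) : ℂ) • tensorVec (ζ k x) (ξ k x)) x₀ :=
    (Filter.eventuallyEq_of_mem hnhds hsum).fderiv_eq
  have hp' (k : ι) : (p k : ℂ) ≠ 0 := by exact_mod_cast (hp k).ne'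
  have hsqrt (k : ι) : (Real.sqrt (p k) : ℂ) * Real.sqrt (p k) = p k := by
    exact_mod_cast Real.mul_self_sqrt (hp k).le
  have hdiv (k l : ι) : (Real.sqrt (p k) : ℂ) * Real.sqrt (p l) * (p l : ℂ)⁻¹
      = Real.sqrt (p k / p l) := by
    have hl : (Real.sqrt (p l) : ℂ) ≠ 0 := by exact_mod_cast (Real.sqrt_pos.2 (hp l)).ne'
    rw [Real.sqrt_div (hp k).le, ← hsqrt l, Complex.ofReal_div]
    field_simp
  rw [hderiv, fderiv_sum_smul_tensorVec _ (fun k => (hζd k).differentiableAt hnhds)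
    (fun k => (hξd k).differentiableAt hnhds), hsum x₀ hx₀, ptraceE_add_left,
    ptraceE_sum_smul, ptraceE_sum_smul]
  simp only [ptraceE_tensorVec, add_mul, Finset.sum_mul, Matrix.smul_mul,
    ketbra_mul_sum_smul_ketbra (hζ x₀ hx₀)]
  congr 1
  · refine Finset.sum_congr rfl fun k _ => ?_
    simp [orthonormal_iff_ite.mp (hξ x₀ hx₀), smul_smul, hsqrt, hp']
  · refine Finset.sum_congr rfl fun k _ => Finset.sum_congr rfl fun l _ => ?_
    rw [smul_smul, smul_smul, ← hdiv]
    congr 1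
    ring
end

section
/- (The statistical average of the C*-geometric phase generator is the geometric phase generator of the universe: tr_S(ρ_a 𝒜_a) = ⟪φ_a, dφ_a⟫.) Let φ : U → ℂ^(n×m) be differentiable at x₀ ∈ U, and set ρ = Tr_E( |φ(x₀)⟩⟨φ(x₀)| ). Suppose Q and σ are n×n complex matrices such that Q is Hermitian, Q·Q = Q, Q·ρ = ρ, and σ·ρ = Q (so that σ acts as a pseudo-inverse of ρ with Q the orthogonal projection onto the range of ρ). Then for every direction u ∈ E: tr( ρ · ( Tr_E( |D_uφ(x₀)⟩⟨φ(x₀)| ) · σ ) ) = ⟪φ(x₀), D_uφ(x₀)⟫. -/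
open scoped ComplexInnerProductSpace

open Matrix in
/-- The partial trace of `|χ⟩⟨ψ|` is the product of the coefficient matrix of `χ` with the
conjugate transpose of that of `ψ`. -/
theorem ptraceE_eq_mul_conjTranspose {n m : Type*} [Fintype n] [Fintype m]
    (χ ψ : EuclideanSpace ℂ (n × m)) :
    ptraceE χ ψ = (of fun i α => χ (i, α)) * (of fun i α => ψ (i, α) : Matrix n m ℂ)ᴴ := by
  ext i j
  simp [ptraceE, mul_apply]

/-- The trace of the partial trace of `|χ⟩⟨ψ|` is `⟪ψ, χ⟫`. -/
theorem trace_ptraceE {n m : Type*} [Fintype n] [Fintype m]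
    (χ ψ : EuclideanSpace ℂ (n × m)) : (ptraceE χ ψ).trace = ⟪ψ, χ⟫ := by
  simp [ptraceE, Matrix.trace, PiLp.inner_apply, Fintype.sum_prod_type]

open Matrix in
open scoped ComplexOrder in
/-- If `Q` fixes `Tr_E(|ψ⟩⟨ψ|)` from the left, then the conjugate transpose of `Q` fixes every
`Tr_E(|χ⟩⟨ψ|)` from the right. -/
theorem ptraceE_mul_conjTranspose_of_mul_ptraceE {n m : Type*} [Fintype n] [Fintype m]
    {Q : Matrix n n ℂ} {ψ : EuclideanSpace ℂ (n × m)} (h : Q * ptraceE ψ ψ = ptraceE ψ ψ)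
    (χ : EuclideanSpace ℂ (n × m)) : ptraceE χ ψ * Qᴴ = ptraceE χ ψ := by
  classical
  rw [ptraceE_eq_mul_conjTranspose] at h ⊢
  have hψ : Q * (of fun i α => ψ (i, α) : Matrix n m ℂ) = of fun i α => ψ (i, α) := by
    have h_sub : (Q - 1) * (of fun i α => ψ (i, α) : Matrix n m ℂ) = 0 := by
      rw [← mul_self_mul_conjTranspose_eq_zero, Matrix.sub_mul, Matrix.one_mul, h, sub_self]
    rwa [Matrix.sub_mul, Matrix.one_mul, sub_eq_zero] at h_sub
  rw [Matrix.mul_assoc, ← conjTranspose_mul, hψ]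

/-- the statistical average of the `C*`-geometric phase generator is the
geometric phase generator of the universe:
`tr(ρ · (Tr_E(|D_uφ⟩⟨φ|) · σ)) = ⟪φ, D_uφ⟫`, where `ρ = Tr_E(|φ⟩⟨φ|)` and `σ` is a
pseudo-inverse of `ρ` with `Q = σρ` the orthogonal projection onto the range of `ρ`. -/
theorem stmt_17
    {E : Type*} [NormedAddCommGroup E] [NormedSpace ℝ E]
    {n m : Type*} [Fintype n] [Fintype m]
    (U : Set E) (hU : IsOpen U) (x₀ : E) (hx₀ : x₀ ∈ U)
    (φ : E → EuclideanSpace ℂ (n × m)) (hφ : DifferentiableAt ℝ φ x₀)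
    (Q σ : Matrix n n ℂ)
    (hQherm : Q.IsHermitian) (hQQ : Q * Q = Q)
    (hQρ : Q * ptraceE (φ x₀) (φ x₀) = ptraceE (φ x₀) (φ x₀))
    (hσρ : σ * ptraceE (φ x₀) (φ x₀) = Q)
    (u : E) :
    (ptraceE (φ x₀) (φ x₀) * (ptraceE (fderiv ℝ φ x₀ u) (φ x₀) * σ)).trace
      = ⟪φ x₀, fderiv ℝ φ x₀ u⟫ := by
  rw [← Matrix.mul_assoc, Matrix.trace_mul_comm, ← Matrix.mul_assoc, hσρ, Matrix.trace_mul_comm,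
    ← hQherm.eq, ptraceE_mul_conjTranspose_of_mul_ptraceE hQρ, trace_ptraceE]
end
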